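/- For a general n-player stage game G (mixed strategies allowed), a necessary condition for the existence of some T ≥ 1 and some subgame-perfect equilibrium of the repeated game G(T) in which local suboptimality occurs is: there exists a mixed strategy profile σ̂ = (σ̂₁, …, σ̂ₙ) such that I(G) ⊆ B(σ̂) and B(σ̂) ≠ [n]; i.e., every player whose Nash equilibrium payoff in G is unique plays a best response in σ̂, yet some player does not play a best response in σ̂. -/

import Mathlib

open Finset

/-- A mixed strategy on a finite action set: a probability distribution. -/
structure Mix (A : Type*) [Fintype A] where
  p : A → ℝ
  nonneg : ∀ a, 0 ≤ p a
  sum_one : ∑ a, p a = 1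

section NPlayer

variable {n : ℕ} {A : Fin n → Type*} [∀ i, Fintype (A i)] [∀ i, DecidableEq (A i)]

/-- Expected payoff of `u` under the mixed strategy profile `σ`. -/
def expPayN (u : (∀ i, A i) → ℝ) (σ : ∀ i, Mix (A i)) : ℝ :=
  ∑ a : ∀ i, A i, (∏ i, (σ i).p (a i)) * u a

/-- Player `i` plays a best response (among mixed strategies) in the profile `σ`. -/
def BRN (u : (∀ i, A i) → ℝ) (σ : ∀ i, Mix (A i)) (i : Fin n) : Prop :=
  ∀ τ : Mix (A i), expPayN u (Function.update σ i τ) ≤ expPayN u σ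

/-- Mixed Nash equilibria of the `n`-player stage game with payoffs `u`. -/
def NashN (u : ∀ _ : Fin n, (∀ j, A j) → ℝ) : Set (∀ i, Mix (A i)) :=
  {σ | ∀ i, BRN (u i) σ i}

/-- `Vᵢ`: the set of payoff values attainable by player `i` at Nash equilibria. -/
def VN (u : ∀ _ : Fin n, (∀ j, A j) → ℝ) (i : Fin n) : Set ℝ :=
  (fun σ => expPayN (u i) σ) '' NashN u

/-- `I(G)`: the set of players with a unique Nash equilibrium payoff. -/
def IG (u : ∀ _ : Fin n, (∀ j, A j) → ℝ) : Set (Fin n) :=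
  {i | ∃ v, VN u i = {v}}

/-- `B(σ)`: the set of players playing a best response in the profile `σ`. -/
def BSet (u : ∀ _ : Fin n, (∀ j, A j) → ℝ) (σ : ∀ i, Mix (A i)) : Set (Fin n) :=
  {i | BRN (u i) σ i}

/-- Expected total payoff (w.r.t. `u`) over `T` remaining rounds, after history `h`,
under the behavior strategy profile `μ`. -/
def totPayN (u : (∀ i, A i) → ℝ) (μ : ∀ i, List (∀ j, A j) → Mix (A i)) :
    ℕ → List (∀ j, A j) → ℝ
  | 0, _ => 0
  | T + 1, h =>
      ∑ a : ∀ i, A i, (∏ i, (μ i h).p (a i)) * (u a + totPayN u μ T (h ++ [a]))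

/-- The behavior strategy profile induced on the subgame following history `h`. -/
def condN (μ : ∀ i, List (∀ j, A j) → Mix (A i)) (h : List (∀ j, A j)) :
    ∀ i, List (∀ j, A j) → Mix (A i) :=
  fun i h' => μ i (h ++ h')

/-- Nash equilibrium of the `T`-round repeated game: no player can increase their
total payoff by a unilateral deviation to another behavior strategy. -/
def isNEN (u : ∀ _ : Fin n, (∀ j, A j) → ℝ) (T : ℕ)
    (μ : ∀ i, List (∀ j, A j) → Mix (A i)) : Prop :=
  ∀ (i : Fin n) (μ' : List (∀ j, A j) → Mix (A i)),
    totPayN (u i) (Function.update μ i μ') T [] ≤ totPayN (u i) μ T []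

/-- Subgame-perfect equilibrium of the `T`-round repeated game. -/
def isSPEN (u : ∀ _ : Fin n, (∀ j, A j) → ℝ) (T : ℕ)
    (μ : ∀ i, List (∀ j, A j) → Mix (A i)) : Prop :=
  ∀ h : List (∀ j, A j), h.length < T → isNEN u (T - h.length) (condN μ h)

end NPlayer

section NPlayerLemmas

variable {n : ℕ} {A : Fin n → Type*} [∀ i, Fintype (A i)]

/-- The weights of a product of mixed strategies sum to one. -/
theorem sum_prod_mix_eq_one (σ : ∀ i, Mix (A i)) : ∑ a : ∀ i, A i, ∏ i, (σ i).p (a i) = 1 := by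
  have h := Finset.prod_univ_sum (fun i => (Finset.univ : Finset (A i))) (fun i a => (σ i).p a)
  rw [Fintype.piFinset_univ] at h
  rw [← h]
  simp [Mix.sum_one]

/-- If the continuation payoff after the current round is a constant `c`, the total payoff is
the stage payoff plus `c`. -/
theorem totPayN_succ_eq_expPayN_add (u : (∀ i, A i) → ℝ)
    (μ : ∀ i, List (∀ j, A j) → Mix (A i)) (r : ℕ) (h : List (∀ j, A j)) (c : ℝ)
    (hc : ∀ a, totPayN u μ r (h ++ [a]) = c) :
    totPayN u μ (r + 1) h = expPayN u (fun i => μ i h) + c := by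
  simp only [totPayN, expPayN, hc, mul_add, Finset.sum_add_distrib]
  rw [← Finset.sum_mul, sum_prod_mix_eq_one, one_mul]

theorem totPayN_condN (u : (∀ i, A i) → ℝ) (μ : ∀ i, List (∀ j, A j) → Mix (A i))
    (h : List (∀ j, A j)) (r : ℕ) (h' : List (∀ j, A j)) :
    totPayN u (condN μ h) r h' = totPayN u μ r (h ++ h') := by
  induction r generalizing h' with
  | zero => rfl
  | succ r ih => simp only [totPayN, ih, condN, List.append_assoc]

/-- The total payoff after a nonempty history does not depend on the behavior in the
first round. -/
theorem totPayN_congr_of_ne_nil (u : (∀ i, A i) → ℝ) {μ ν : ∀ i, List (∀ j, A j) → Mix (A i)}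
    (hμν : ∀ i h, h ≠ [] → μ i h = ν i h) (r : ℕ) (h : List (∀ j, A j)) (hh : h ≠ []) :
    totPayN u μ r h = totPayN u ν r h := by
  induction r generalizing h with
  | zero => rfl
  | succ r ih =>
    simp only [totPayN]
    refine Finset.sum_congr rfl fun a _ => ?_
    rw [ih (h ++ [a]) (by simp)]
    simp only [hμν _ h hh]

/-- Play `τ` in the first round and follow `m` afterwards. -/
def deviateFirst {H S : Type*} (τ : S) (m : List H → S) : List H → S
  | [] => τ
  | a :: h => m (a :: h)

/-- In a Nash equilibrium of the repeated game, a player whose continuation payoff does not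
depend on the outcome of the first round plays a best response in the first round. -/
theorem isNEN.brn_of_const_continuation {u : ∀ _ : Fin n, (∀ j, A j) → ℝ} {r : ℕ}
    {μ : ∀ i, List (∀ j, A j) → Mix (A i)} (hμ : isNEN u (r + 1) μ) {i : Fin n} {c : ℝ}
    (hc : ∀ a, totPayN (u i) μ r [a] = c) : BRN (u i) (fun j => μ j []) i := by
  intro τ
  have key := hμ i (deviateFirst τ (μ i))
  have hcongr : ∀ j h, h ≠ [] →
      Function.update μ i (deviateFirst τ (μ i)) j h = μ j h := by
    intro j h hh
    obtain ⟨a, l, rfl⟩ := List.exists_cons_of_ne_nil hh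
    rcases eq_or_ne j i with rfl | hj
    · simp [deviateFirst]
    · simp [hj]
  rw [totPayN_succ_eq_expPayN_add _ μ r [] c hc, totPayN_succ_eq_expPayN_add _ _ r [] c
    (fun a => (totPayN_congr_of_ne_nil _ hcongr r _ (by simp)).trans (hc a))] at key
  have hstage : (fun j => Function.update μ i (deviateFirst τ (μ i)) j []) =
      Function.update (fun j => μ j []) i τ := by
    funext j
    rcases eq_or_ne j i with rfl | hj
    · simp [deviateFirst]
    · simp [hj]
  rw [hstage] at key
  linarith

/-- If best responses by all players with a unique Nash payoff force a Nash equilibrium, then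
in every SPE those players' continuation payoffs are multiples of their Nash payoffs. -/
theorem isSPEN.totPayN_eq {u : ∀ _ : Fin n, (∀ j, A j) → ℝ} {T : ℕ}
    {μ : ∀ i, List (∀ j, A j) → Mix (A i)} (hμ : isSPEN u T μ)
    (hB : ∀ σ : ∀ i, Mix (A i), IG u ⊆ BSet u σ → σ ∈ NashN u) (r : ℕ) :
    ∀ h : List (∀ j, A j), h.length + r = T →
      ∀ i v, VN u i = {v} → totPayN (u i) μ r h = r * v := by
  induction r with
  | zero => intro h _ i v _; simp [totPayN]
  | succ r ih =>
    intro h hT i v hv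
    have hcont : ∀ i v, VN u i = {v} → ∀ a, totPayN (u i) μ r (h ++ [a]) = r * v :=
      fun i v hv a => ih _ (by simp; omega) i v hv
    have hNash : (fun j => μ j h) ∈ NashN u := by
      refine hB _ fun j ⟨w, hw⟩ => ?_
      have hne := hμ h (by omega)
      rw [show T - h.length = r + 1 by omega] at hne
      simpa [condN, BSet] using hne.brn_of_const_continuation (i := j) (c := r * w)
        fun a => (totPayN_condN _ μ h r [a]).trans (hcont j w hw a)
    have hstage : expPayN (u i) (fun j => μ j h) = v := by
      have hmem : expPayN (u i) (fun j => μ j h) ∈ VN u i := ⟨_, hNash, rfl⟩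
      rwa [hv] at hmem
    rw [totPayN_succ_eq_expPayN_add _ μ r h _ (hcont i v hv), hstage]
    push_cast
    ring

end NPlayerLemmas

section NPlayer

variable {n : ℕ} {A : Fin n → Type*} [∀ i, Fintype (A i)] [∀ i, DecidableEq (A i)]

/-- Theorem (n-player, necessary condition): if local suboptimality occurs in some SPE
of some finitely repeated game `G(T)`, then there is a mixed strategy profile `σ` in
which every player with a unique Nash payoff plays a best response but some player
does not. -/
theorem nPlayer_necessary_condition [∀ i, Nonempty (A i)]
    (u : ∀ _ : Fin n, (∀ j, A j) → ℝ)
    (hLS : ∃ T : ℕ, 1 ≤ T ∧ ∃ μ : ∀ i, List (∀ j, A j) → Mix (A i),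
      isSPEN u T μ ∧ ∃ h : List (∀ j, A j), h.length < T ∧ (fun i => μ i h) ∉ NashN u) :
    ∃ σ : ∀ i, Mix (A i), IG u ⊆ BSet u σ ∧ BSet u σ ≠ Set.univ := by
  obtain ⟨T, -, μ, hμ, h, hh, hnot⟩ := hLS
  by_contra! hcon
  have hB : ∀ σ : ∀ i, Mix (A i), IG u ⊆ BSet u σ → σ ∈ NashN u :=
    fun σ hσ => Set.eq_univ_iff_forall.mp (hcon σ hσ)
  refine hnot (hB _ fun j ⟨w, hw⟩ => ?_)
  obtain ⟨r, hr⟩ : ∃ r, T - h.length = r + 1 := ⟨T - h.length - 1, by omega⟩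
  have hne := hμ h hh
  rw [hr] at hne
  simpa [condN, BSet] using hne.brn_of_const_continuation (i := j) (c := r * w)
    fun a => (totPayN_condN _ μ h r [a]).trans
      (hμ.totPayN_eq hB r _ (by simp; omega) j w hw)

end NPlayer
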